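/- Let $N$ and $F$ act on the $n$-dimensional vector space $V$ over $\overline{\mathbb{Q}}_\ell$ (or any characteristic-zero field) with basis $e_0,\ldots,e_{n-1}$ via $F(e_i) = q^i e_i$, $N(e_0)=0$, $N(e_i)=e_{i-1}$, extended to $\mathrm{Sym}^k(V)$ where $F$ acts multiplicatively and $N$ as a derivation. Then $\det(I - FT \mid \ker(N: \mathrm{Sym}^k V \to \mathrm{Sym}^k V)) = \prod_{u=0}^{\lfloor k(n-1)/2 \rfloor} (1 - q^u T)^{m_k(u)}$, where $m_k(u) = c_k(u) - c_k(u-1)$ and $c_k(u)$ is the number of $(i_0,\ldots,i_{n-1}) \in \mathbb{Z}_{\geq 0}^n$ with $\sum i_j = k$ and $\sum j\, i_j = u$. -/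

import Mathlib

open MvPolynomial Polynomial

namespace Stmt12Aux

/-! ### Abstract linear algebra -/

theorem charpoly_of_internal {K V : Type*} [Field K] [AddCommGroup V] [Module K V]
    [Module.Finite K V] (f : Module.End K V) {m : ℕ} (μ : ℕ → K)
    (hμ : Function.Injective μ) (A : ℕ → Submodule K V)
    (hA : ∀ u, ∀ v ∈ A u, f v = μ u • v)
    (htop : (⨆ u : Fin m, A u) = ⊤) :
    f.charpoly = ∏ u ∈ Finset.range m,
      (Polynomial.X - Polynomial.C (μ u)) ^ (Module.finrank K (A u)) := by
  classical
  have hind : iSupIndep (fun u : Fin m => A u) := by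
    have h1 := (Module.End.eigenspaces_iSupIndep f).comp
      (f := fun u : Fin m => μ u) (fun a b h => Fin.ext (hμ h))
    refine h1.mono fun u v hv => ?_
    simpa [Module.End.mem_eigenspace_iff] using hA u v hv
  have hint := DirectSum.isInternal_submodule_of_iSupIndep_of_iSup_eq_top hind htop
  let b := hint.collectedBasis (fun u : Fin m => Module.finBasis K (A u))
  have hb : ∀ i, f (b i) = μ i.1 • b i := fun i =>
    hA _ _ (hint.collectedBasis_mem _ i)
  have hmat : LinearMap.toMatrix b b f = Matrix.diagonal (fun i => μ i.1) := by
    ext i j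
    rw [LinearMap.toMatrix_apply, hb, Matrix.diagonal_apply]
    by_cases h : i = j
    · subst h; simp
    · simp [h, Finsupp.single_apply, Ne.symm h]
  rw [← LinearMap.charpoly_toMatrix f b, hmat, Matrix.charpoly_diagonal,
    Fintype.prod_sigma, Finset.prod_range]
  simp

section sl2

variable {K V : Type*} [Field K] [CharZero K] [AddCommGroup V] [Module K V]
  (G : ℤ → Submodule K V) (N E : Module.End K V) (M : ℤ)

theorem NE_inj (hN : ∀ u, ∀ v ∈ G u, N v ∈ G (u - 1)) (hneg : ∀ u < 0, G u = ⊥)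
    (hcomm : ∀ u, ∀ v ∈ G u, N (E v) - E (N v) = ((M - 2 * u : ℤ) : K) • v) :
    ∀ (t : ℕ) (u : ℤ), u < t → 2 * u < M → ∀ (a : ℤ), 0 ≤ a → ∀ v ∈ G u,
      N (E v) = (-(a : ℤ) : K) • v → v = 0 := by
  intro t
  induction t with
  | zero =>
    intro u hu _ a _ v hv _
    rw [hneg u (by simpa using hu)] at hv
    simpa using hv
  | succ t ih =>
    intro u hu hM a ha v hv h
    have h1 : E (N v) = (-((a + (M - 2 * u) : ℤ)) : K) • v := by
      have := hcomm u v hv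
      rw [sub_eq_iff_eq_add, h] at this
      rw [← sub_eq_iff_eq_add'] at this
      rw [← this, ← sub_smul]; congr 1; push_cast; ring
    have h2 : N v = 0 := by
      refine ih (u - 1) (by push_cast at hu; omega) (by omega) (a + (M - 2 * u)) (by omega) _
        (hN u v hv) ?_
      rw [h1, map_smul]
    rw [h2, map_zero] at h1
    rcases smul_eq_zero.1 h1.symm with h3 | h3
    · rw [neg_eq_zero, Int.cast_eq_zero] at h3; omega
    · exact h3

theorem EN_inj (hE : ∀ u, ∀ v ∈ G u, E v ∈ G (u + 1)) (hbig : ∀ u, M < u → G u = ⊥)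
    (hcomm : ∀ u, ∀ v ∈ G u, N (E v) - E (N v) = ((M - 2 * u : ℤ) : K) • v) :
    ∀ (t : ℕ) (u : ℤ), M - t < u → M < 2 * u → ∀ (a : ℤ), 0 ≤ a → ∀ v ∈ G u,
      E (N v) = (-(a : ℤ) : K) • v → v = 0 := by
  intro t
  induction t with
  | zero =>
    intro u hu _ a _ v hv _
    rw [hbig u (by simpa using hu)] at hv
    simpa using hv
  | succ t ih =>
    intro u hu hM a ha v hv h
    have h1 : N (E v) = (-((a + (2 * u - M) : ℤ)) : K) • v := by
      have := hcomm u v hv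
      rw [sub_eq_iff_eq_add, h] at this
      rw [this, ← add_smul]; congr 1; push_cast; ring
    have h2 : E v = 0 := by
      refine ih (u + 1) (by push_cast at hu; omega) (by omega) (a + (2 * u - M)) (by omega) _
        (hE u v hv) ?_
      rw [h1, map_smul]
    rw [h2, map_zero] at h1
    rcases smul_eq_zero.1 h1.symm with h3 | h3
    · rw [neg_eq_zero, Int.cast_eq_zero] at h3; omega
    · exact h3

theorem N_inj (hE : ∀ u, ∀ v ∈ G u, E v ∈ G (u + 1)) (hbig : ∀ u, M < u → G u = ⊥)
    (hcomm : ∀ u, ∀ v ∈ G u, N (E v) - E (N v) = ((M - 2 * u : ℤ) : K) • v)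
    (u : ℤ) (hu : M < 2 * u) (v : V) (hv : v ∈ G u) (h : N v = 0) : v = 0 :=
  EN_inj G N E M hE hbig hcomm (M - u + 1).toNat u (by omega) hu 0 le_rfl v hv (by simp [h])

theorem finrank_ker (hN : ∀ u, ∀ v ∈ G u, N v ∈ G (u - 1))
    (hE : ∀ u, ∀ v ∈ G u, E v ∈ G (u + 1)) (hneg : ∀ u < 0, G u = ⊥)
    (hcomm : ∀ u, ∀ v ∈ G u, N (E v) - E (N v) = ((M - 2 * u : ℤ) : K) • v)
    [∀ u, Module.Finite K (G u)] (u : ℤ) (hu : 2 * u ≤ M) :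
    Module.finrank K (G u ⊓ LinearMap.ker N : Submodule K V) =
      Module.finrank K (G u) - Module.finrank K (G (u - 1)) := by
  let f : G u →ₗ[K] G (u - 1) := N.restrict (hN u)
  have hE' : ∀ v ∈ G (u - 1), E v ∈ G u := fun v hv => by
    simpa using hE (u - 1) v hv
  let g : G (u - 1) →ₗ[K] G u := E.restrict hE'
  have hinj : Function.Injective (f ∘ₗ g) := by
    rw [← LinearMap.ker_eq_bot, LinearMap.ker_eq_bot']
    rintro ⟨v, hv⟩ h
    have h' : N (E v) = 0 := congrArg Subtype.val h
    refine Subtype.ext (NE_inj G N E M hN hneg hcomm (u.toNat) (u - 1) (by omega) (by omega)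
      0 le_rfl v hv (by simpa using h'))
  have hsurj : Function.Surjective f := by
    have := LinearMap.surjective_of_injective hinj
    rw [LinearMap.coe_comp] at this
    exact this.of_comp
  have h1 := f.finrank_range_add_finrank_ker
  rw [LinearMap.range_eq_top.2 hsurj, finrank_top] at h1
  have h2 : Module.finrank K (LinearMap.ker f) =
      Module.finrank K (G u ⊓ LinearMap.ker N : Submodule K V) := by
    have : (LinearMap.ker f).map (G u).subtype = G u ⊓ LinearMap.ker N := by
      ext x
      simp only [Submodule.mem_map, LinearMap.mem_ker, Submodule.mem_inf]
      constructor
      · rintro ⟨⟨y, hy⟩, h, rfl⟩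
        exact ⟨hy, congrArg Subtype.val h⟩
      · rintro ⟨h, h'⟩
        exact ⟨⟨x, h⟩, Subtype.ext h', rfl⟩
    rw [← this]
    exact (Submodule.equivMapOfInjective _ (Submodule.injective_subtype _) _).finrank_eq
  omega

end sl2

/-! ### Weight spaces of polynomials -/

section poly

variable (K : Type*) [Field K] (n : ℕ)

/-- The bidegree. -/
def wt (j : Fin n) : ℤ × ℤ := (1, (j : ℤ))

theorem weight_wt (d : Fin n →₀ ℕ) :
    Finsupp.weight (wt n) d = (((∑ j, d j : ℕ) : ℤ), ((∑ j : Fin n, (j : ℕ) * d j : ℕ) : ℤ)) := by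
  rw [Finsupp.weight_apply, Finsupp.sum_fintype _ _ (by simp)]
  ext
  · simp [wt, Prod.fst_sum]
  · simp [wt, Prod.snd_sum, mul_comm]

/-- The derivation `N`. -/
noncomputable def ND : Derivation K (MvPolynomial (Fin n) K) (MvPolynomial (Fin n) K) :=
  ∑ j : Fin n, if h : (j : ℕ) = 0 then 0
    else (MvPolynomial.X (⟨(j : ℕ) - 1, Nat.lt_of_le_of_lt (Nat.sub_le _ _) j.isLt⟩ : Fin n) :
      MvPolynomial (Fin n) K) • pderiv j

/-- The opposite derivation. -/
noncomputable def ED : Derivation K (MvPolynomial (Fin n) K) (MvPolynomial (Fin n) K) :=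
  ∑ j : Fin n, if h : (j : ℕ) + 1 < n then
    (MvPolynomial.C ((((j : ℕ) + 1) * ((n : ℤ) - 1 - (j : ℕ)) : ℤ) : K) *
      MvPolynomial.X (⟨(j : ℕ) + 1, h⟩ : Fin n) :
      MvPolynomial (Fin n) K) • pderiv j else 0

/-- The weight derivation. -/
noncomputable def HD : Derivation K (MvPolynomial (Fin n) K) (MvPolynomial (Fin n) K) :=
  ∑ j : Fin n, (MvPolynomial.C (((n : ℤ) - 1 - 2 * (j : ℕ) : ℤ) : K) *
      MvPolynomial.X j : MvPolynomial (Fin n) K) • pderiv j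

theorem ND_apply (p) : ND K n p = ∑ j : Fin n, if h : (j : ℕ) = 0 then 0
    else MvPolynomial.X (⟨(j : ℕ) - 1, Nat.lt_of_le_of_lt (Nat.sub_le _ _) j.isLt⟩ : Fin n)
      * pderiv j p := by
  rw [ND, ← Derivation.coeFnAddMonoidHom_apply, map_sum, Finset.sum_apply]
  refine Finset.sum_congr rfl fun j _ => ?_
  split_ifs <;> simp

theorem ED_apply (p) : ED K n p = ∑ j : Fin n, if h : (j : ℕ) + 1 < n then
    (MvPolynomial.C ((((j : ℕ) + 1) * ((n : ℤ) - 1 - (j : ℕ)) : ℤ) : K) *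
      MvPolynomial.X (⟨(j : ℕ) + 1, h⟩ : Fin n)) * pderiv j p else 0 := by
  rw [ED, ← Derivation.coeFnAddMonoidHom_apply, map_sum, Finset.sum_apply]
  refine Finset.sum_congr rfl fun j _ => ?_
  split_ifs <;> simp

theorem HD_apply (p) : HD K n p = ∑ j : Fin n,
    (MvPolynomial.C (((n : ℤ) - 1 - 2 * (j : ℕ) : ℤ) : K) * MvPolynomial.X j) * pderiv j p := by
  rw [HD, ← Derivation.coeFnAddMonoidHom_apply, map_sum, Finset.sum_apply]
  refine Finset.sum_congr rfl fun j _ => ?_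
  simp

theorem ND_X (i : Fin n) : ND K n (MvPolynomial.X i) = if h : (i : ℕ) = 0 then 0
    else MvPolynomial.X (⟨(i : ℕ) - 1, Nat.lt_of_le_of_lt (Nat.sub_le _ _) i.isLt⟩ : Fin n) := by
  rw [ND_apply, Finset.sum_eq_single i]
  · simp
  · intro j _ hj
    rw [pderiv_X_of_ne (Ne.symm hj)]; simp
  · simp

theorem ED_X (i : Fin n) : ED K n (MvPolynomial.X i) = if h : (i : ℕ) + 1 < n then
    (MvPolynomial.C ((((i : ℕ) + 1) * ((n : ℤ) - 1 - (i : ℕ)) : ℤ) : K) *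
      MvPolynomial.X (⟨(i : ℕ) + 1, h⟩ : Fin n)) else 0 := by
  rw [ED_apply, Finset.sum_eq_single i]
  · simp
  · intro j _ hj
    rw [pderiv_X_of_ne (Ne.symm hj)]; simp
  · simp

theorem HD_X (i : Fin n) : HD K n (MvPolynomial.X i) =
    (MvPolynomial.C (((n : ℤ) - 1 - 2 * (i : ℕ) : ℤ) : K) * MvPolynomial.X i) := by
  rw [HD_apply, Finset.sum_eq_single i]
  · simp
  · intro j _ hj
    rw [pderiv_X_of_ne (Ne.symm hj)]; simp
  · simp

theorem comm_eq : ⁅ND K n, ED K n⁆ = HD K n := by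
  apply MvPolynomial.derivation_ext
  rintro ⟨i, hi⟩
  rw [Derivation.commutator_apply, ND_X, ED_X, HD_X]
  have h2 : (MvPolynomial.C (2 : K) : MvPolynomial (Fin n) K) = 2 := map_ofNat _ 2
  rcases i with _ | i
  · by_cases h : 1 < n
    · simp [h, MvPolynomial.derivation_C_mul, ND_X, MvPolynomial.smul_eq_C_mul]
    · obtain rfl : n = 1 := by omega
      simp
  · by_cases h : i + 1 + 1 < n
    · simp [h, hi, MvPolynomial.derivation_C_mul, ND_X, ED_X]
      rw [h2]
      ring
    · obtain rfl : n = i + 1 + 1 := by omega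
      simp [ED_X]
      rw [h2]
      ring

theorem ND_wh {m : ℤ × ℤ} {p : MvPolynomial (Fin n) K} (hp : IsWeightedHomogeneous (wt n) p m) :
    IsWeightedHomogeneous (wt n) (ND K n p) (m - (0, 1)) := by
  rw [ND_apply]
  refine IsWeightedHomogeneous.sum _ _ _ fun j _ => ?_
  split_ifs with h
  · exact isWeightedHomogeneous_zero _ _ _
  · have h1 := (isWeightedHomogeneous_X K (wt n) (⟨(j : ℕ) - 1, Nat.lt_of_le_of_lt (Nat.sub_le _ _) j.isLt⟩ : Fin n)).mul (hp.pderiv (i := j) (sub_add_cancel m (wt n j)))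
    convert h1 using 1
    ext
    · simp [wt]
    · simp [wt]; omega

theorem ED_wh {m : ℤ × ℤ} {p : MvPolynomial (Fin n) K} (hp : IsWeightedHomogeneous (wt n) p m) :
    IsWeightedHomogeneous (wt n) (ED K n p) (m + (0, 1)) := by
  rw [ED_apply]
  refine IsWeightedHomogeneous.sum _ _ _ fun j _ => ?_
  split_ifs with h
  · have h1 := ((isWeightedHomogeneous_X K (wt n) (⟨(j : ℕ) + 1, h⟩ : Fin n)).C_mul
      ((((j : ℕ) + 1) * ((n : ℤ) - 1 - (j : ℕ)) : ℤ) : K)).mul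
      (hp.pderiv (i := j) (sub_add_cancel m (wt n j)))
    convert h1 using 1
    ext
    · simp [wt]
    · simp [wt]; omega
  · exact isWeightedHomogeneous_zero _ _ _

theorem HD_wh {k u : ℤ} {p : MvPolynomial (Fin n) K}
    (hp : IsWeightedHomogeneous (wt n) p (k, u)) :
    HD K n p = ((k * (n - 1) - 2 * u : ℤ) : K) • p := by
  induction hp using IsWeightedHomogeneous.induction_on with
  | zero => simp
  | add p q hp hq h1 h2 => rw [map_add, h1, h2, smul_add]
  | monomial d r hr =>
    rw [weight_wt, Prod.mk.injEq] at hr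
    rw [HD_apply]
    simp_rw [mul_assoc, X_mul_pderiv_monomial, ← MvPolynomial.smul_eq_C_mul, ← Nat.cast_smul_eq_nsmul K, smul_smul, ← Finset.sum_smul]
    congr 1
    rw [← hr.1, ← hr.2]
    push_cast
    rw [Finset.mul_sum, Finset.sum_mul, ← Finset.sum_sub_distrib]
    refine Finset.sum_congr rfl fun j _ => ?_
    ring

/-- Weight spaces. -/
noncomputable def GG (k : ℕ) (u : ℤ) : Submodule K (MvPolynomial (Fin n) K) :=
  weightedHomogeneousSubmodule K (wt n) ((k : ℤ), u)

theorem comm_GG (k : ℕ) (u : ℤ) (v) (hv : v ∈ GG K n k u) :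
    (ND K n).toLinearMap ((ED K n).toLinearMap v) - (ED K n).toLinearMap ((ND K n).toLinearMap v)
      = (((k : ℤ) * (n - 1) - 2 * u : ℤ) : K) • v := by
  rw [← HD_wh K n hv, ← comm_eq, Derivation.commutator_apply]
  rfl

theorem GG_neg (k : ℕ) (u : ℤ) (hu : u < 0) : GG K n k u = ⊥ := by
  rw [eq_bot_iff]
  intro p hp
  refine IsWeightedHomogeneous.eq_zero_of_no_monomials (w := wt n) (n := ((k : ℤ), u)) hp ?_
  intro d hd
  rw [weight_wt, Prod.mk.injEq] at hd
  omega

theorem GG_big (k : ℕ) (u : ℤ) (hu : (k : ℤ) * (n - 1) < u) : GG K n k u = ⊥ := by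
  rw [eq_bot_iff]
  intro p hp
  refine IsWeightedHomogeneous.eq_zero_of_no_monomials (w := wt n) (n := ((k : ℤ), u)) hp ?_
  intro d hd
  rw [weight_wt, Prod.mk.injEq] at hd
  rw [← hd.1, ← hd.2] at hu
  push_cast at hu
  rw [Finset.sum_mul] at hu
  refine absurd hu (not_lt.2 (Finset.sum_le_sum fun j _ => ?_))
  rw [mul_comm]
  have := j.isLt
  exact mul_le_mul_of_nonneg_left (by omega) (by positivity)

theorem GG_eq (k : ℕ) (u : ℕ) : GG K n k u = restrictSupport K
    {d : Fin n →₀ ℕ | (∑ j, d j) = k ∧ (∑ j : Fin n, (j : ℕ) * d j) = u} := by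
  ext p
  rw [GG, mem_weightedHomogeneousSubmodule, mem_restrictSupport_iff]
  simp only [IsWeightedHomogeneous, weight_wt, Prod.mk.injEq, Set.subset_def, Finset.mem_coe,
    MvPolynomial.mem_support_iff, Set.mem_ofPred_eq, Nat.cast_inj]

theorem fin_tuples (k u : ℕ) :
    Finite {i : Fin n → ℕ // (∑ j : Fin n, i j) = k ∧ (∑ j : Fin n, (j : ℕ) * i j) = u} := by
  refine Set.Finite.to_subtype (s := {i : Fin n → ℕ | (∑ j : Fin n, i j) = k ∧ (∑ j : Fin n, (j : ℕ) * i j) = u})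
    ((Set.finite_Iic (fun _ : Fin n => k)).subset ?_)
  rintro i ⟨h, _⟩ j
  rw [← h]
  exact Finset.single_le_sum (f := i) (fun _ _ => Nat.zero_le _) (Finset.mem_univ j)

/-- Reindexing exponents. -/
noncomputable def tupEquiv (k u : ℕ) :
    {d : Fin n →₀ ℕ | (∑ j, d j) = k ∧ (∑ j : Fin n, (j : ℕ) * d j) = u} ≃
    {i : Fin n → ℕ // (∑ j : Fin n, i j) = k ∧ (∑ j : Fin n, (j : ℕ) * i j) = u} :=
  Finsupp.equivFunOnFinite.subtypeEquiv (fun _ => Iff.rfl)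

theorem GG_finrank (k u : ℕ) : Module.finrank K (GG K n k u) =
    Nat.card {i : Fin n → ℕ // (∑ j : Fin n, i j) = k ∧ (∑ j : Fin n, (j : ℕ) * i j) = u} := by
  rw [GG_eq, Module.finrank_eq_nat_card_basis (basisRestrictSupport K _)]
  exact Nat.card_congr (tupEquiv n k u)

instance GG_finite (k : ℕ) (u : ℤ) : Module.Finite K (GG K n k u) := by
  rcases lt_or_ge u 0 with h | h
  · rw [GG_neg K n k u h]; infer_instance
  · lift u to ℕ using h
    rw [GG_eq]
    have := fin_tuples n k u
    have := Finite.of_equiv _ (tupEquiv n k u).symm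
    exact Module.Finite.of_basis (basisRestrictSupport K _)

theorem F_GG (q : K) (k u : ℕ) (p) (hp : p ∈ GG K n k u) :
    MvPolynomial.aeval (fun j : Fin n => q ^ (j : ℕ) • (MvPolynomial.X j : MvPolynomial (Fin n) K)) p = q ^ u • p := by
  have hp' : IsWeightedHomogeneous (wt n) p ((k : ℤ), (u : ℤ)) := hp
  clear hp
  induction hp' using IsWeightedHomogeneous.induction_on with
  | zero => simp
  | add p q hp hq h1 h2 => rw [map_add, h1, h2, smul_add]
  | monomial d r hr =>
    rw [weight_wt, Prod.mk.injEq, Nat.cast_inj, Nat.cast_inj] at hr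
    rw [MvPolynomial.aeval_monomial, Finsupp.prod_fintype _ _ (by simp)]
    simp_rw [_root_.smul_pow, Finset.prod_smul, ← pow_mul]
    rw [Finset.prod_pow_eq_pow_sum, hr.2, mul_smul_comm]
    congr 1
    rw [MvPolynomial.monomial_eq, Finsupp.prod_fintype _ _ (by simp)]
    rfl

theorem GG_le_hom (k : ℕ) (u : ℤ) : GG K n k u ≤ homogeneousSubmodule (Fin n) K k := by
  intro p hp d hd
  have h : Finsupp.weight (wt n) d = _ := hp hd
  rw [weight_wt, Prod.mk.injEq, Nat.cast_inj] at h
  rw [Finsupp.weight_apply, Finsupp.sum_fintype _ _ (by simp), ← h.1]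
  simp

theorem ND_comp (m : ℤ × ℤ) (p : MvPolynomial (Fin n) K) :
    ND K n (weightedHomogeneousComponent (wt n) m p) =
      weightedHomogeneousComponent (wt n) (m - (0, 1)) (ND K n p) := by
  classical
  induction p using MvPolynomial.induction_on' with
  | add p q h1 h2 => simp only [map_add, h1, h2]
  | monomial d r =>
    have h := isWeightedHomogeneous_monomial (wt n) d r rfl
    rw [weightedHomogeneousComponent_of_mem (m := m) h,
      weightedHomogeneousComponent_of_mem (m := m - (0, 1)) (ND_wh K n h)]
    simp only [sub_left_inj]
    split_ifs <;> simp

theorem W_le (k m : ℕ) (hn : 1 ≤ n) [CharZero K] (hm : m = k * (n - 1) / 2 + 1) :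
    homogeneousSubmodule (Fin n) K k ⊓ LinearMap.ker (ND K n).toLinearMap ≤
      ⨆ u : Fin m, (GG K n k (u : ℕ) ⊓ LinearMap.ker (ND K n).toLinearMap) := by
  classical
  rintro p ⟨hp, hpN⟩
  have hpN' : ND K n p = 0 := hpN
  rw [← finsum_weightedHomogeneousComponent (wt n) p]
  refine finsum_induction (fun x => x ∈ _) (Submodule.zero_mem _)
    (fun _ _ => Submodule.add_mem _) ?_
  rintro ⟨a, u⟩
  by_cases h0 : weightedHomogeneousComponent (wt n) (a, u) p = 0
  · rw [h0]; exact Submodule.zero_mem _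
  have hker : ND K n (weightedHomogeneousComponent (wt n) (a, u) p) = 0 := by
    rw [ND_comp, hpN', map_zero]
  have ha : a = k := by
    obtain ⟨d, hd⟩ := MvPolynomial.exists_coeff_ne_zero h0
    rw [coeff_weightedHomogeneousComponent] at hd
    split_ifs at hd with hw
    · have h1 := hp hd
      rw [Finsupp.weight_apply, Finsupp.sum_fintype _ _ (by simp)] at h1
      rw [weight_wt, Prod.mk.injEq] at hw
      rw [← hw.1, ← h1]; simp
    · exact absurd rfl hd
  subst ha
  have hG : weightedHomogeneousComponent (wt n) ((k : ℤ), u) p ∈ GG K n k u :=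
    weightedHomogeneousComponent_mem _ _ _
  have hu0 : 0 ≤ u := by
    by_contra h
    rw [GG_neg K n k u (by omega)] at hG
    exact h0 (by simpa using hG)
  lift u to ℕ using hu0
  have hu : 2 * (u : ℤ) ≤ (k : ℤ) * (n - 1) := by
    by_contra h
    exact h0 (N_inj (GG K n k) (ND K n).toLinearMap (ED K n).toLinearMap ((k : ℤ) * (n - 1))
      (fun u v hv => by simpa [GG] using ED_wh K n hv) (GG_big K n k)
      (fun u v hv => comm_GG K n k u v hv) u (by omega) _ hG hker)
  have hu' : u < m := by
    have : ((k * (n - 1) : ℕ) : ℤ) = (k : ℤ) * (n - 1) := by push_cast [hn]; rfl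
    rw [← this] at hu
    omega
  exact Submodule.mem_iSup_of_mem (p := fun u : Fin m =>
    (GG K n k (u : ℕ) ⊓ LinearMap.ker (ND K n).toLinearMap)) ⟨u, hu'⟩ ⟨hG, hker⟩

end poly
end Stmt12Aux

open Stmt12Aux in
/-- Local factor at 0: model `Sym^k V` (with `V` spanned by `e_0,…,e_{n-1}`,
`F e_i = q^i e_i`, `N e_0 = 0`, `N e_i = e_{i-1}`) as the degree-`k`
homogeneous part of `K[X_0,…,X_{n-1}]`, with `F` acting multiplicatively and
`N` as the derivation `∑_{j≥1} X_{j-1} ∂_j`.  Then the characteristic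
polynomial of `F` restricted to `ker N ∩ Sym^k V` is
`∏_{u=0}^{⌊k(n-1)/2⌋} (X - q^u)^{m_k(u)}`, i.e.
`det(I - F·T | ker N) = ∏_u (1 - q^u T)^{m_k(u)}`,
where `m_k(u) = c_k(u) - c_k(u-1)` and `c_k(u)` counts tuples
`(i_0,…,i_{n-1})` with `∑ i_j = k` and `∑ j i_j = u`. -/
theorem stmt_12 (K : Type*) [Field K] [CharZero K]
    (q : K) (hq0 : q ≠ 0) (hq : ∀ m : ℕ, 0 < m → q ^ m ≠ 1)
    (n k : ℕ) (hn : 2 ≤ n) (hk : 1 ≤ k)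
    (Fop Nop : Module.End K (MvPolynomial (Fin n) K))
    (hFop : ∀ p, Fop p = MvPolynomial.aeval (fun j : Fin n => q ^ (j : ℕ) • X j) p)
    (hNop : ∀ p, Nop p = ∑ j : Fin n,
      if h : (j : ℕ) = 0 then 0
      else X (⟨(j : ℕ) - 1, Nat.lt_of_le_of_lt (Nat.sub_le _ _) j.isLt⟩ : Fin n) * pderiv j p)
    (c : ℕ → ℕ)
    (hc : ∀ u, c u =
      Nat.card {i : Fin n → ℕ // (∑ j : Fin n, i j) = k ∧ (∑ j : Fin n, (j : ℕ) * i j) = u})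
    (W : Submodule K (MvPolynomial (Fin n) K))
    (hW : W = homogeneousSubmodule (Fin n) K k ⊓ LinearMap.ker Nop)
    [Module.Finite K W]
    (hmap : ∀ v ∈ W, Fop v ∈ W) :
    LinearMap.charpoly (Fop.restrict hmap) =
      ∏ u ∈ Finset.range (k * (n - 1) / 2 + 1),
        (Polynomial.X - Polynomial.C (q ^ u)) ^ (c u - if u = 0 then 0 else c (u - 1)) := by
  have hND : Nop = (ND K n).toLinearMap := by
    refine LinearMap.ext fun p => ?_
    rw [hNop]
    exact (ND_apply K n p).symm
  have hinj : Function.Injective (fun u : ℕ => q ^ u) := by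
    intro a b hab
    by_contra hne
    rcases lt_or_gt_of_ne hne with h | h
    · exact hq (b - a) (by omega) (by
        have : q ^ b = q ^ a * q ^ (b - a) := by rw [← pow_add]; congr 1; omega
        have hab' : q ^ a = q ^ b := hab
        rw [← hab'] at this
        exact (mul_eq_left₀ (pow_ne_zero _ hq0)).1 this.symm)
    · exact hq (a - b) (by omega) (by
        have : q ^ a = q ^ b * q ^ (a - b) := by rw [← pow_add]; congr 1; omega
        have hab' : q ^ a = q ^ b := hab
        rw [hab'] at this
        exact (mul_eq_left₀ (pow_ne_zero _ hq0)).1 this.symm)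
  have hle : ∀ u : ℕ, GG K n k u ⊓ LinearMap.ker Nop ≤ W := fun u => by
    rw [hW]; exact inf_le_inf_right _ (GG_le_hom K n k u)
  rw [charpoly_of_internal (Fop.restrict hmap) (m := k * (n - 1) / 2 + 1) (fun u => q ^ u) hinj
    (fun u => (GG K n k (u : ℕ) ⊓ LinearMap.ker Nop).comap W.subtype)]
  · refine Finset.prod_congr rfl fun u hu => ?_
    congr 1
    rw [(Submodule.comapSubtypeEquivOfLe (hle u)).finrank_eq, hND]
    have hu' : 2 * (u : ℤ) ≤ (k : ℤ) * (n - 1) := by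
      have h1 : ((k * (n - 1) : ℕ) : ℤ) = (k : ℤ) * (n - 1) := by
        rw [Nat.cast_mul, Nat.cast_sub (by omega)]; simp
      rw [← h1]
      rw [Finset.mem_range] at hu
      omega
    rw [finrank_ker (GG K n k) _ (ED K n).toLinearMap ((k : ℤ) * (n - 1))
      (fun u v hv => by simpa [GG] using ND_wh K n hv)
      (fun u v hv => by simpa [GG] using ED_wh K n hv) (GG_neg K n k)
      (fun u v hv => comm_GG K n k u v hv) u hu', GG_finrank, ← hc]
    congr 1
    split_ifs with h
    · subst h
      rw [GG_neg K n k _ (by simp)]; simp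
    · rw [show (u : ℤ) - 1 = ((u - 1 : ℕ) : ℤ) by omega, GG_finrank, ← hc]
  · rintro u ⟨v, hvW⟩ ⟨hv, _⟩
    apply Subtype.ext
    have := F_GG K n q k u v hv
    rw [← hFop] at this
    exact this
  · apply Submodule.map_injective_of_injective W.injective_subtype
    rw [Submodule.map_iSup, Submodule.map_top, Submodule.range_subtype]
    simp_rw [Submodule.map_comap_subtype]
    apply le_antisymm
    · exact iSup_le fun u => inf_le_left
    · have h1 := W_le K n k (k * (n - 1) / 2 + 1) (by omega) rfl
      rw [← hND, ← hW] at h1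
      refine h1.trans (iSup_mono fun u => le_inf (hle u) le_rfl)
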